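/- Let a ≥ 2 be an integer. Let T₁ = Σ_{i₁=1}^{2} Σ_{i₂=1}^{2} Σ_{i₃=1}^{a+2} e_{i₁} ⊗ e_{i₂} ⊗ e_{i₃} ⊗ e_{(i₁,i₂,i₃)} ∈ ℂ² ⊗ ℂ² ⊗ ℂ^{a+2} ⊗ ℂ^{4(a+2)} and let T₂ = Σ_{j=1}^{a} e_j ⊗ e_j ⊗ e₀ ⊗ e₀ ∈ ℂ^a ⊗ ℂ^a ⊗ ℂ¹ ⊗ ℂ¹. Then R̲(T₁) = 4(a+2), R̲(T₂) = a, and R̲(T₁ ⊕ T₂) = 4(a+2) + 1. -/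

import Mathlib

open Finset

namespace Subadditivity

noncomputable section

/-- A tensor of order `k` over `ℂ` with `i`-th factor the space `ℂ^{ι i}` of complex-valued
functions on the finite index type `ι i`; the tensor is represented by the array of its
coordinates with respect to the standard basis, i.e. by an element of
`ℂ^{ι 0} ⊗ ⋯ ⊗ ℂ^{ι (k-1)} ≃ ((∀ i, ι i) → ℂ)`. -/
abbrev Tensor {k : ℕ} (ι : Fin k → Type) : Type := (∀ i, ι i) → ℂ

/-- `T` is a sum of `r` simple (rank-one) tensors `v j 0 ⊗ ⋯ ⊗ v j (k-1)`. -/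
def HasRankLE {k : ℕ} {ι : Fin k → Type} (T : Tensor ι) (r : ℕ) : Prop :=
  ∃ v : Fin r → (∀ i, ι i → ℂ), T = fun x => ∑ j : Fin r, ∏ i : Fin k, v j i (x i)

/-- Tensor rank: the least `r` such that `T` is a sum of `r` simple tensors. -/
noncomputable def rank {k : ℕ} {ι : Fin k → Type} (T : Tensor ι) : ℕ :=
  sInf {r | HasRankLE T r}

/-- Border rank is at most `r`: `T` lies in the closure of the set of tensors of rank `≤ r`. -/
def HasBorderRankLE {k : ℕ} {ι : Fin k → Type} (T : Tensor ι) (r : ℕ) : Prop :=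
  T ∈ closure {S : Tensor ι | HasRankLE S r}

/-- Border rank. -/
noncomputable def borderRank {k : ℕ} {ι : Fin k → Type} (T : Tensor ι) : ℕ :=
  sInf {r | HasBorderRankLE T r}

open scoped Classical in
/-- Direct sum of two tensors of order `k`: the coordinates supported on the `ι`-part are
those of `T`, the coordinates supported on the `κ`-part are those of `S`, and all mixed
coordinates vanish. -/
noncomputable def dsum {k : ℕ} {ι κ : Fin k → Type} (T : Tensor ι) (S : Tensor κ) :
    Tensor (fun i => ι i ⊕ κ i) := fun x =>
  (if h : ∃ y : ∀ i, ι i, x = fun i => Sum.inl (y i) then T h.choose else 0) +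
  (if h : ∃ z : ∀ i, κ i, x = fun i => Sum.inr (z i) then S h.choose else 0)

/-- Kronecker product of two tensors of order `k`. -/
def kron {k : ℕ} {ι κ : Fin k → Type} (T : Tensor ι) (S : Tensor κ) :
    Tensor (fun i => ι i × κ i) := fun x =>
  T (fun i => (x i).1) * S (fun i => (x i).2)

/-- `N`-th Kronecker power of a tensor of order `k`. -/
def kpow {k : ℕ} {ι : Fin k → Type} (T : Tensor ι) (N : ℕ) :
    Tensor (fun i => Fin N → ι i) := fun x => ∏ j : Fin N, T (fun i => x i j)

/-- The unit tensor `u_k(r) = Σ_{j=1}^r e_j ⊗ ⋯ ⊗ e_j` of order `k`. -/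
def unit (k r : ℕ) : Tensor (fun _ : Fin k => Fin r) := fun x =>
  ∑ j : Fin r, ∏ i : Fin k, (if x i = j then (1 : ℂ) else 0)

/-- `S` is a degeneration of `T`: `S` lies in the closure of the set of tensors obtained
from `T` by applying linear maps `A i` on each factor. -/
def Degen {k : ℕ} {ι κ : Fin k → Type} [∀ i, Fintype (κ i)]
    (S : Tensor ι) (T : Tensor κ) : Prop :=
  S ∈ closure {S' : Tensor ι | ∃ A : ∀ i, ι i → κ i → ℂ,
    S' = fun x => ∑ y : ∀ i, κ i, (∏ i : Fin k, A i (x i) (y i)) * T y}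

/-- Kronecker delta. -/
def delta {α : Type} [DecidableEq α] (a b : α) : ℂ := if a = b then 1 else 0

/-- The order-4 "spider" tensor
`Σ_{i₁,i₂,i₃} e_{i₁} ⊗ e_{i₂} ⊗ e_{i₃} ⊗ e_{(i₁,i₂,i₃)} ∈ ℂ^{m₁} ⊗ ℂ^{m₂} ⊗ ℂ^{m₃} ⊗ ℂ^{m₁m₂m₃}`,
the last factor being indexed by triples. -/
def spider3 (m₁ m₂ m₃ : ℕ) :
    Tensor ![Fin m₁, Fin m₂, Fin m₃, Fin m₁ × Fin m₂ × Fin m₃] := fun x =>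
  delta (α := Fin m₁ × Fin m₂ × Fin m₃) (x 3) (x 0, x 1, x 2)

/-- The order-4 tensor `Σ_{j=1}^N e_j ⊗ e_j ⊗ e₀ ⊗ e₀ ∈ ℂ^N ⊗ ℂ^N ⊗ ℂ¹ ⊗ ℂ¹`. -/
def matTensor4 (N : ℕ) : Tensor ![Fin N, Fin N, Fin 1, Fin 1] := fun x =>
  delta (α := Fin N) (x 0) (x 1)

/-- The order-4 tensor `Σ_{ℓ=1}^M e_ℓ ⊗ e_ℓ ⊗ e_ℓ ⊗ e₀ ∈ ℂ^M ⊗ ℂ^M ⊗ ℂ^M ⊗ ℂ¹`. -/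
def ghz4 (M : ℕ) : Tensor ![Fin M, Fin M, Fin M, Fin 1] := fun x =>
  delta (α := Fin M) (x 0) (x 1) * delta (α := Fin M) (x 1) (x 2)

section RankBounds

variable {k : ℕ} {ι κ : Fin k → Type}

lemma hasRankLE_sum {J : Type*} [Fintype J] (v : J → ∀ i, ι i → ℂ) :
    HasRankLE (fun x => ∑ j, ∏ i, v j i (x i)) (Fintype.card J) :=
  ⟨fun j => v ((Fintype.equivFin J).symm j), funext fun x =>
    ((Fintype.equivFin J).symm.sum_comp fun j => ∏ i, v j i (x i)).symm⟩

lemma HasRankLE.hasBorderRankLE {T : Tensor ι} {r : ℕ} (h : HasRankLE T r) :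
    HasBorderRankLE T r :=
  subset_closure h

lemma borderRank_eq {T : Tensor ι} {r : ℕ} (h : HasBorderRankLE T r)
    (h' : ∀ s, HasBorderRankLE T s → r ≤ s) : borderRank T = r :=
  le_antisymm (Nat.sInf_le h) (le_csInf ⟨r, h⟩ h')

/-- Submatrix of the flattening of `S` that separates the `m`-th factor from the others. -/
def flattening {n : Type*} (m : Fin k) (ρ : n → ι m) (σ : n → ∀ i, ι i) (S : Tensor ι) :
    Matrix n n ℂ :=
  Matrix.of fun p q => S (Function.update (σ q) m (ρ p))

lemma HasRankLE.rank_flattening_le {n : Type*} [Fintype n] {S : Tensor ι} {r : ℕ}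
    (h : HasRankLE S r) (m : Fin k) (ρ : n → ι m) (σ : n → ∀ i, ι i) :
    (flattening m ρ σ S).rank ≤ r := by
  obtain ⟨v, rfl⟩ := h
  have key : flattening m ρ σ (fun x => ∑ j : Fin r, ∏ i, v j i (x i)) =
      (Matrix.of fun p j => v j m (ρ p)) *
        (Matrix.of fun (j : Fin r) q => ∏ i ∈ univ.erase m, v j i (σ q i)) := by
    ext p q
    simp only [flattening, Matrix.of_apply, Matrix.mul_apply]
    refine sum_congr rfl fun j _ => ?_
    rw [← mul_prod_erase univ _ (mem_univ m)]
    congr 1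
    · simp
    · exact prod_congr rfl fun i hi => by rw [Function.update_of_ne (ne_of_mem_erase hi)]
  rw [key]
  exact (Matrix.rank_mul_le_left _ _).trans ((Matrix.rank_le_card_width _).trans (by simp))

lemma HasBorderRankLE.card_le {n : Type*} [Fintype n] [DecidableEq n] {T : Tensor ι} {r : ℕ}
    (h : HasBorderRankLE T r) (m : Fin k) (ρ : n → ι m) (σ : n → ∀ i, ι i)
    (hT : flattening m ρ σ T = 1) : Fintype.card n ≤ r := by
  by_contra! hr
  have hcont : Continuous fun S : Tensor ι => (flattening m ρ σ S).det :=
    Continuous.matrix_det (continuous_matrix fun p q => continuous_apply _)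
  have hclosed : IsClosed {S : Tensor ι | (flattening m ρ σ S).det = 0} :=
    isClosed_eq hcont continuous_const
  have hsub : {S : Tensor ι | HasRankLE S r} ⊆ {S | (flattening m ρ σ S).det = 0} := by
    intro S hS
    by_contra hdet
    have hunit : IsUnit (flattening m ρ σ S) :=
      (Matrix.isUnit_iff_isUnit_det _).2 (isUnit_iff_ne_zero.2 hdet)
    have := hS.rank_flattening_le m ρ σ
    rw [Matrix.rank_of_isUnit _ hunit] at this
    omega
  have : (flattening m ρ σ T).det = 0 := closure_minimal hsub hclosed h
  simp [hT] at this

lemma dsum_inl [NeZero k] (T : Tensor ι) (S : Tensor κ) (y : ∀ i, ι i) :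
    dsum T S (fun i => Sum.inl (y i)) = T y := by
  have h : ∃ y' : ∀ i, ι i, (fun i => Sum.inl (β := κ i) (y i)) = fun i => Sum.inl (y' i) :=
    ⟨y, rfl⟩
  have h' : ¬ ∃ z : ∀ i, κ i, (fun i => Sum.inl (β := κ i) (y i)) = fun i => Sum.inr (z i) := by
    rintro ⟨z, hz⟩
    exact Sum.inl_ne_inr (congrFun hz 0)
  rw [dsum, dif_pos h, dif_neg h', add_zero]
  congr 1
  funext i
  exact (Sum.inl_injective (congrFun h.choose_spec i)).symm

lemma dsum_inr [NeZero k] (T : Tensor ι) (S : Tensor κ) (z : ∀ i, κ i) :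
    dsum T S (fun i => Sum.inr (z i)) = S z := by
  have h : ∃ z' : ∀ i, κ i, (fun i => Sum.inr (α := ι i) (z i)) = fun i => Sum.inr (z' i) :=
    ⟨z, rfl⟩
  have h' : ¬ ∃ y : ∀ i, ι i, (fun i => Sum.inr (α := ι i) (z i)) = fun i => Sum.inl (y i) := by
    rintro ⟨y, hy⟩
    exact Sum.inr_ne_inl (congrFun hy 0)
  rw [dsum, dif_pos h, dif_neg h', zero_add]
  congr 1
  funext i
  exact (Sum.inr_injective (congrFun h.choose_spec i)).symm

lemma dsum_mixed (T : Tensor ι) (S : Tensor κ) (x : ∀ i, ι i ⊕ κ i) {i j : Fin k}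
    (hi : (x i).isLeft) (hj : (x j).isRight) : dsum T S x = 0 := by
  rw [dsum, dif_neg, dif_neg, add_zero]
  · rintro ⟨z, rfl⟩
    simp at hi
  · rintro ⟨y, rfl⟩
    simp at hj

/-- The direct sum of two sums of simple tensors, as a sum of simple tensors. -/
lemma dsum_sum [NeZero k] {J L : Type*} [Fintype J] [Fintype L] (v : J → ∀ i, ι i → ℂ)
    (w : L → ∀ i, κ i → ℂ) (x : ∀ i, ι i ⊕ κ i) :
    dsum (fun y => ∑ j, ∏ i, v j i (y i)) (fun z => ∑ l, ∏ i, w l i (z i)) x =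
      ∑ j, ∏ i, Sum.elim (v j i) 0 (x i) + ∑ l, ∏ i, Sum.elim 0 (w l i) (x i) := by
  by_cases hl : ∀ i, (x i).isLeft
  · choose y hy using fun i => Sum.isLeft_iff.1 (hl i)
    obtain rfl : x = fun i => Sum.inl (y i) := funext hy
    simp [dsum_inl, prod_const, NeZero.ne k]
  by_cases hr : ∀ i, (x i).isRight
  · choose z hz using fun i => Sum.isRight_iff.1 (hr i)
    obtain rfl : x = fun i => Sum.inr (z i) := funext hz
    simp [dsum_inr, prod_const, NeZero.ne k]
  push Not at hl hr
  obtain ⟨j, hj⟩ := hl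
  obtain ⟨i, hi⟩ := hr
  rw [ne_eq, Sum.not_isLeft] at hj
  rw [ne_eq, Sum.not_isRight] at hi
  rw [dsum_mixed _ _ x hi hj]
  obtain ⟨y, hy⟩ := Sum.isLeft_iff.1 hi
  obtain ⟨z, hz⟩ := Sum.isRight_iff.1 hj
  rw [sum_eq_zero fun l _ => prod_eq_zero (mem_univ j) (by simp [hz]),
    sum_eq_zero fun l _ => prod_eq_zero (mem_univ i) (by simp [hy]), add_zero]

end RankBounds

lemma delta_self {α : Type} [DecidableEq α] (a : α) : delta a a = 1 := if_pos rfl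

lemma delta_triple {α β γ : Type} [DecidableEq α] [DecidableEq β] [DecidableEq γ] (a : α) (b : β)
    (c : γ) (t : α × β × γ) :
    delta t (a, b, c) = delta a t.1 * delta b t.2.1 * delta c t.2.2 * delta t t := by
  obtain ⟨a', b', c'⟩ := t
  rw [delta_self, mul_one]
  simp only [delta, Prod.mk.injEq, eq_comm (a := a'), eq_comm (a := b'), eq_comm (a := c'),
    ← ite_and, mul_ite, mul_one, mul_zero]
  congr 1
  simp only [eq_iff_iff]
  tauto

/-- The vectors whose tensor products are the terms of `spider3`. -/
def spiderVec (m₁ m₂ m₃ : ℕ) (t : Fin m₁ × Fin m₂ × Fin m₃) :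
    ∀ i, ![Fin m₁, Fin m₂, Fin m₃, Fin m₁ × Fin m₂ × Fin m₃] i → ℂ :=
  Fin.cons (fun p : Fin m₁ => delta p t.1) <| Fin.cons (fun p : Fin m₂ => delta p t.2.1) <|
    Fin.cons (fun p : Fin m₃ => delta p t.2.2) <|
      Fin.cons (fun p : Fin m₁ × Fin m₂ × Fin m₃ => delta p t) finZeroElim

/-- The vectors whose tensor products are the terms of `matTensor4`. -/
def matVec (N : ℕ) (l : Fin N) : ∀ i, ![Fin N, Fin N, Fin 1, Fin 1] i → ℂ :=
  Fin.cons (fun p : Fin N => delta p l) <| Fin.cons (fun p : Fin N => delta p l) <|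
    Fin.cons (fun _ : Fin 1 => 1) <| Fin.cons (fun _ : Fin 1 => 1) finZeroElim

lemma spider3_eq (m₁ m₂ m₃ : ℕ) :
    spider3 m₁ m₂ m₃ = fun x => ∑ t, ∏ i, spiderVec m₁ m₂ m₃ t i (x i) := by
  funext x
  refine Eq.symm ((sum_eq_single (x 3) ?_ ?_).trans ?_)
  rotate_left 2
  · simp only [Fin.prod_univ_four]
    exact (delta_triple (α := Fin m₁) (β := Fin m₂) (γ := Fin m₃) (x 0) (x 1) (x 2) (x 3)).symm
  · intro t _ ht
    refine prod_eq_zero (mem_univ 3) ?_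
    exact if_neg ht.symm
  · exact fun h => (h (mem_univ (α := Fin m₁ × Fin m₂ × Fin m₃) _)).elim

lemma matTensor4_eq (N : ℕ) : matTensor4 N = fun x => ∑ l, ∏ i, matVec N l i (x i) := by
  funext x
  refine Eq.symm ((sum_eq_single (x 1) ?_ ?_).trans ?_)
  rotate_left 2
  · simp only [Fin.prod_univ_four]
    have h (p q : Fin N) : delta p q * delta q q * 1 * 1 = delta p q := by simp [delta_self]
    exact h (x 0) (x 1)
  · intro l _ hl
    refine prod_eq_zero (mem_univ 1) ?_
    exact if_neg hl.symm
  · exact fun h => (h (mem_univ (α := Fin N) _)).elim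

/-- The basis index `(i₁, i₂, i₃, (i₁, i₂, i₃))` of the ambient space of `spider3`. -/
def spiderIdx {m₁ m₂ m₃ : ℕ} (t : Fin m₁ × Fin m₂ × Fin m₃) :
    ∀ i, ![Fin m₁, Fin m₂, Fin m₃, Fin m₁ × Fin m₂ × Fin m₃] i :=
  Fin.cons t.1 <| Fin.cons t.2.1 <| Fin.cons t.2.2 <| Fin.cons t finZeroElim

/-- The basis index `(l, l, 0, 0)` of the ambient space of `matTensor4`. -/
def matIdx {N : ℕ} (l : Fin N) : ∀ i, ![Fin N, Fin N, Fin 1, Fin 1] i :=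
  Fin.cons l <| Fin.cons l <| Fin.cons (0 : Fin 1) <| Fin.cons (0 : Fin 1) finZeroElim

lemma flattening_spider3 (m₁ m₂ m₃ : ℕ) :
    flattening (n := Fin m₁ × Fin m₂ × Fin m₃) 3 (fun t => t) spiderIdx
      (spider3 m₁ m₂ m₃) = 1 := by
  ext p q
  change delta p q = _
  simp [delta, Matrix.one_apply]

lemma flattening_matTensor4 (N : ℕ) :
    flattening (n := Fin N) 0 (fun l => l) matIdx (matTensor4 N) = 1 := by
  ext p q
  change delta p q = _
  simp [delta, Matrix.one_apply]

/-- Basis indices of the ambient space of `dsum (spider3 m₁ m₂ m₃) (matTensor4 N)`. -/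
def dsumIdx (m₁ m₂ m₃ N : ℕ) [NeZero N] : (Fin m₁ × Fin m₂ × Fin m₃) ⊕ Fin 1 →
    ∀ i, ![Fin m₁, Fin m₂, Fin m₃, Fin m₁ × Fin m₂ × Fin m₃] i ⊕ ![Fin N, Fin N, Fin 1, Fin 1] i
  | .inl t => fun i => Sum.inl (spiderIdx t i)
  | .inr _ => fun i => Sum.inr (matIdx 0 i)

lemma update_dsumIdx_inl {m₁ m₂ m₃ N : ℕ} [NeZero N] (p q : Fin m₁ × Fin m₂ × Fin m₃) :
    Function.update (dsumIdx m₁ m₂ m₃ N (.inl q)) 3 (.inl p) =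
      fun i => Sum.inl (Function.update (spiderIdx q) 3 p i) := by
  funext i
  fin_cases i <;> rfl

lemma update_dsumIdx_inr {m₁ m₂ m₃ N : ℕ} [NeZero N] (p q : Fin 1) :
    Function.update (dsumIdx m₁ m₂ m₃ N (.inr q)) 3 (.inr p) =
      fun i => Sum.inr (Function.update (matIdx 0) 3 p i) := by
  funext i
  fin_cases i <;> rfl

lemma flattening_dsum (m₁ m₂ m₃ N : ℕ) [NeZero N] :
    flattening (n := (Fin m₁ × Fin m₂ × Fin m₃) ⊕ Fin 1) 3 (fun t => t) (dsumIdx m₁ m₂ m₃ N)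
      (dsum (spider3 m₁ m₂ m₃) (matTensor4 N)) = 1 := by
  ext p q
  simp only [flattening, Matrix.of_apply]
  rcases p with p | p <;> rcases q with q | q
  · refine (congrArg (dsum _ _) (update_dsumIdx_inl p q)).trans ?_
    rw [dsum_inl]
    change delta p q = _
    simp [delta, Matrix.one_apply]
  · rw [dsum_mixed (i := 3) (j := 0) _ _ _ rfl rfl]
    simp
  · rw [dsum_mixed (i := 0) (j := 3) _ _ _ rfl rfl]
    simp
  · refine (congrArg (dsum _ _) (update_dsumIdx_inr p q)).trans ?_
    rw [dsum_inr]
    change delta (0 : Fin N) 0 = _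
    rw [delta_self, Subsingleton.elim p q, Matrix.one_apply_eq]

/-- The signs `1, -1`. -/
def sgn (i : Fin 2) : ℂ := ![1, -1] i

/-- Weights summing to zero. -/
def wt (a : ℕ) (l : Fin (a + 2)) : ℂ := if l.val = a + 1 then -(a + 1) else 1

/-- The perturbation of the first factor. -/
def pertX (a : ℕ) (l : Fin (a + 2)) (p : Fin a) : ℂ :=
  if l.val = p.val then 1 else if l.val = a then -1 else 0

/-- The perturbation of the second factor. -/
def pertY (a : ℕ) (l : Fin (a + 2)) (p : Fin a) : ℂ :=
  if l.val = p.val then 1 else if l.val = a + 1 then (a + 1 : ℂ)⁻¹ else 0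

lemma sum_wt (a : ℕ) : ∑ l, wt a l = 0 := by
  have h (l : Fin a) : l.val ≠ a + 1 := by omega
  simp [Fin.sum_univ_castSucc, wt, h]

lemma sum_wt_pertX (a : ℕ) (p : Fin a) : ∑ l, wt a l * pertX a l p = 0 := by
  have h (l : Fin a) : l.val ≠ a + 1 := by omega
  have h' (l : Fin a) : l.val ≠ a := by omega
  have h₁ : a ≠ p.val := by omega
  have h₂ : a + 1 ≠ p.val := by omega
  simp [Fin.sum_univ_castSucc, wt, pertX, h, h', h₁, h₂, Fin.val_inj]

lemma sum_wt_pertY (a : ℕ) (p : Fin a) : ∑ l, wt a l * pertY a l p = 0 := by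
  have h (l : Fin a) : l.val ≠ a + 1 := by omega
  have h₁ : a ≠ p.val := by omega
  have h₂ : a + 1 ≠ p.val := by omega
  have h₃ : (a + 1 : ℂ) ≠ 0 := by exact_mod_cast a.succ_ne_zero
  have h₄ : (-1 + -a : ℂ) * (a + 1 : ℂ)⁻¹ = -1 := by field_simp; ring
  simp [Fin.sum_univ_castSucc, wt, pertY, h, h₁, h₂, Fin.val_inj, h₄]

lemma sum_wt_pertX_pertY (a : ℕ) (p q : Fin a) :
    ∑ l, wt a l * pertX a l p * pertY a l q = ∑ l, delta p l * delta q l := by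
  have h (l : Fin a) : l.val ≠ a + 1 := by omega
  have h' (l : Fin a) : l.val ≠ a := by omega
  have h₁ (p : Fin a) : a ≠ p.val := by omega
  simp [Fin.sum_univ_castSucc, wt, pertX, pertY, h, h', h₁, Fin.val_inj, delta, eq_comm]

lemma perturbed_sum {m : ℕ} (u v : Fin 2 → ℂ) (w A X Y : Fin m → ℂ)
    (z : Fin 2 × Fin 2 × Fin m → ℂ) (c d ε β : ℂ) (hβ : 4 * ε ^ 3 * β = 1)
    (hA : ∑ l, A l = 0) (hX : ∑ l, A l * X l = 0) (hY : ∑ l, A l * Y l = 0) :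
    ∑ t : Fin 2 × Fin 2 × Fin m, (u t.1 + ε * sgn t.1 * X t.2.2) *
        (v t.2.1 + ε * sgn t.2.1 * Y t.2.2) * (w t.2.2 + ε * sgn t.1 * sgn t.2.1 * A t.2.2 * c) *
        (z t + β * d) - (∑ i, u i) * (∑ j, v j) * (∑ l, w l) * (β * d) =
      ∑ t : Fin 2 × Fin 2 × Fin m, (u t.1 + ε * sgn t.1 * X t.2.2) *
        (v t.2.1 + ε * sgn t.2.1 * Y t.2.2) * (w t.2.2 + ε * sgn t.1 * sgn t.2.1 * A t.2.2 * c) *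
        z t + (∑ l, A l * X l * Y l) * c * d := by
  simp only [mul_add (_ * _ * _), sum_add_distrib, add_sub_assoc]
  congr 1
  have key : ∑ t : Fin 2 × Fin 2 × Fin m, (u t.1 + ε * sgn t.1 * X t.2.2) *
        (v t.2.1 + ε * sgn t.2.1 * Y t.2.2) * (w t.2.2 + ε * sgn t.1 * sgn t.2.1 * A t.2.2 * c) *
        (β * d) = (∑ l, w l) * ((u 0 + u 1) * (v 0 + v 1) * (β * d)) +
      (∑ l, A l) * (ε * c * (u 0 - u 1) * (v 0 - v 1) * (β * d)) +
      (∑ l, A l * X l) * (2 * ε ^ 2 * c * (v 0 - v 1) * (β * d)) +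
      (∑ l, A l * Y l) * (2 * ε ^ 2 * c * (u 0 - u 1) * (β * d)) +
      (∑ l, A l * X l * Y l) * (4 * ε ^ 3 * β * (c * d)) := by
    simp only [Fintype.sum_prod_type, Fin.sum_univ_two, sum_mul, ← sum_add_distrib]
    refine sum_congr rfl fun l _ => ?_
    simp only [sgn, Matrix.cons_val_zero, Matrix.cons_val_one]
    ring
  rw [key, hA, hX, hY, hβ]
  simp only [Fin.sum_univ_two]
  ring

/-- The simple summands of the approximating tensors of rank `4 * (a + 2) + 1`. -/
def approxVec (a : ℕ) (ε : ℂ) : Option (Fin 2 × Fin 2 × Fin (a + 2)) →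
    ∀ i, ![Fin 2, Fin 2, Fin (a + 2), Fin 2 × Fin 2 × Fin (a + 2)] i ⊕
      ![Fin a, Fin a, Fin 1, Fin 1] i → ℂ
  | some t => Fin.cons
      (Sum.elim (fun p : Fin 2 => delta p t.1) fun p : Fin a => ε * sgn t.1 * pertX a t.2.2 p) <|
    Fin.cons
      (Sum.elim (fun p : Fin 2 => delta p t.2.1)
        fun p : Fin a => ε * sgn t.2.1 * pertY a t.2.2 p) <|
    Fin.cons
      (Sum.elim (fun p : Fin (a + 2) => delta p t.2.2)
        fun _ : Fin 1 => ε * sgn t.1 * sgn t.2.1 * wt a t.2.2) <|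
    Fin.cons
      (Sum.elim (fun p : Fin 2 × Fin 2 × Fin (a + 2) => delta p t)
        fun _ : Fin 1 => (4 * ε ^ 3)⁻¹) finZeroElim
  | none => Fin.cons (Sum.elim (fun _ : Fin 2 => 1) fun _ : Fin a => 0) <|
    Fin.cons (Sum.elim (fun _ : Fin 2 => 1) fun _ : Fin a => 0) <|
    Fin.cons (Sum.elim (fun _ : Fin (a + 2) => 1) fun _ : Fin 1 => 0) <|
    Fin.cons (Sum.elim (fun _ : Fin 2 × Fin 2 × Fin (a + 2) => 0)
      fun _ : Fin 1 => -(4 * ε ^ 3)⁻¹) finZeroElim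

/-- Coordinates in the first summand, extended by zero. -/
abbrev elimL {α β : Type} (f : α → ℂ) : α ⊕ β → ℂ := Sum.elim f fun _ => 0

/-- Coordinates in the second summand, extended by zero. -/
abbrev elimR {α β : Type} (f : β → ℂ) : α ⊕ β → ℂ := Sum.elim (fun _ => 0) f

/-- The coordinates of the approximating tensors, with the negative powers of `ε` cancelled. -/
def approxCoord (a : ℕ) (p q : Fin 2 ⊕ Fin a) (r : Fin (a + 2) ⊕ Fin 1)
    (s : (Fin 2 × Fin 2 × Fin (a + 2)) ⊕ Fin 1) (ε : ℂ) : ℂ :=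
  ∑ t : Fin 2 × Fin 2 × Fin (a + 2),
    (elimL (fun p => delta p t.1) p + ε * sgn t.1 * elimR (pertX a t.2.2) p) *
    (elimL (fun q => delta q t.2.1) q + ε * sgn t.2.1 * elimR (pertY a t.2.2) q) *
    (elimL (fun r => delta r t.2.2) r +
      ε * sgn t.1 * sgn t.2.1 * wt a t.2.2 * elimR (fun _ => 1) r) *
    elimL (fun s => delta s t) s +
  (∑ l, elimR (fun p => delta p l) p * elimR (fun q => delta q l) q) *
    elimR (fun _ => 1) r * elimR (fun _ => 1) s

lemma sum_delta {n : Type} [Fintype n] [DecidableEq n] (p : n) : ∑ l, delta p l = 1 := by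
  simp [delta]

lemma sum_elimL_delta {n β : Type} [Fintype n] [DecidableEq n] (p : n ⊕ β) :
    ∑ l, elimL (fun p => delta p l) p = elimL (fun _ => 1) p := by
  rcases p with p | p <;> simp [sum_delta]

lemma elim_eq_elimL_add {α β : Type} (f : α → ℂ) (c : ℂ) (g : β → ℂ) (p : α ⊕ β) :
    Sum.elim f (fun b => c * g b) p = elimL f p + c * elimR g p := by
  rcases p with p | p <;> simp

lemma sum_approxVec (a : ℕ) {ε : ℂ} (hε : ε ≠ 0)
    (x : ∀ i, ![Fin 2, Fin 2, Fin (a + 2), Fin 2 × Fin 2 × Fin (a + 2)] i ⊕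
      ![Fin a, Fin a, Fin 1, Fin 1] i) :
    ∑ j, ∏ i, approxVec a ε j i (x i) = approxCoord a (x 0) (x 1) (x 2) (x 3) ε := by
  have hβ : 4 * ε ^ 3 * (4 * ε ^ 3)⁻¹ = 1 := mul_inv_cancel₀ (by simpa using hε)
  have hX (p : Fin 2 ⊕ Fin a) :
      ∑ l, wt a l * elimR (pertX a l) p = 0 := by
    rcases p with p | p <;> simp [sum_wt_pertX]
  have hY (q : Fin 2 ⊕ Fin a) :
      ∑ l, wt a l * elimR (pertY a l) q = 0 := by
    rcases q with q | q <;> simp [sum_wt_pertY]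
  have hXY (p q : Fin 2 ⊕ Fin a) :
      ∑ l, wt a l * elimR (pertX a l) p * elimR (pertY a l) q =
        ∑ l, elimR (fun p => delta p l) p * elimR (fun q => delta q l) q := by
    rcases p with p | p <;> rcases q with q | q <;> simp [sum_wt_pertX_pertY]
  rw [Fintype.sum_option, add_comm]
  simp only [Fin.prod_univ_four]
  have key (p q : Fin 2 ⊕ Fin a) (r : Fin (a + 2) ⊕ Fin 1)
      (s : (Fin 2 × Fin 2 × Fin (a + 2)) ⊕ Fin 1) :
      ∑ t : Fin 2 × Fin 2 × Fin (a + 2),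
        Sum.elim (fun p => delta p t.1) (fun p => ε * sgn t.1 * pertX a t.2.2 p) p *
        Sum.elim (fun p => delta p t.2.1) (fun p => ε * sgn t.2.1 * pertY a t.2.2 p) q *
        Sum.elim (fun p => delta p t.2.2)
          (fun _ => ε * sgn t.1 * sgn t.2.1 * wt a t.2.2) r *
        Sum.elim (fun p => delta p t) (fun _ => (4 * ε ^ 3)⁻¹) s +
      elimL (fun _ => 1) p * elimL (fun _ => 1) q * elimL (fun _ => 1) r *
        elimR (fun _ => -(4 * ε ^ 3)⁻¹) s = approxCoord a p q r s ε := by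
    rw [approxCoord, ← hXY, ← perturbed_sum (fun l => elimL (fun p => delta p l) p)
      (fun l => elimL (fun q => delta q l) q) (fun l => elimL (fun r => delta r l) r) (wt a)
      (fun l => elimR (pertX a l) p) (fun l => elimR (pertY a l) q)
      (fun t => elimL (fun s => delta s t) s) (elimR (fun _ => 1) r) (elimR (fun _ => 1) s)
      ε _ hβ (sum_wt a) (hX p) (hY q), sum_elimL_delta, sum_elimL_delta, sum_elimL_delta, sub_eq_add_neg]
    congr 1
    · refine sum_congr rfl fun t _ => ?_
      rw [← elim_eq_elimL_add, ← elim_eq_elimL_add, ← elim_eq_elimL_add, ← elim_eq_elimL_add]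
      simp only [mul_one]
    · rcases s with s | s <;> simp
  exact key (x 0) (x 1) (x 2) (x 3)

lemma approxCoord_zero (a : ℕ)
    (x : ∀ i, ![Fin 2, Fin 2, Fin (a + 2), Fin 2 × Fin 2 × Fin (a + 2)] i ⊕
      ![Fin a, Fin a, Fin 1, Fin 1] i) :
    approxCoord a (x 0) (x 1) (x 2) (x 3) 0 =
      dsum (spider3 2 2 (a + 2)) (matTensor4 a) x := by
  rw [spider3_eq, matTensor4_eq, dsum_sum]
  simp only [Fin.prod_univ_four, approxCoord, zero_mul, add_zero, sum_mul]
  rfl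

lemma hasBorderRankLE_dsum (a : ℕ) :
    HasBorderRankLE (dsum (spider3 2 2 (a + 2)) (matTensor4 a)) (4 * (a + 2) + 1) := by
  have hcard : Fintype.card (Option (Fin 2 × Fin 2 × Fin (a + 2))) = 4 * (a + 2) + 1 := by
    simp
    ring
  have hlim : Filter.Tendsto
      (fun ε : ℂ => fun x => approxCoord a (x 0) (x 1) (x 2) (x 3) ε)
      (nhdsWithin 0 {0}ᶜ) (nhds (dsum (spider3 2 2 (a + 2)) (matTensor4 a))) := by
    refine Filter.Tendsto.mono_left (tendsto_pi_nhds.2 fun x => ?_) nhdsWithin_le_nhds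
    rw [← approxCoord_zero]
    refine Continuous.tendsto ?_ 0
    unfold approxCoord
    fun_prop
  refine mem_closure_of_tendsto hlim ?_
  filter_upwards [self_mem_nhdsWithin] with ε hε
  have := hasRankLE_sum (approxVec a ε)
  rw [hcard] at this
  exact (funext fun x => sum_approxVec a hε x) ▸ this


/-- Theorem: Construction 2. For `a ≥ 2`, with
`T₁ = Σ e_{i₁} ⊗ e_{i₂} ⊗ e_{i₃} ⊗ e_{(i₁,i₂,i₃)} ∈ ℂ² ⊗ ℂ² ⊗ ℂ^{a+2} ⊗ ℂ^{4(a+2)}` and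
`T₂ = Σ_{j=1}^a e_j ⊗ e_j ⊗ e₀ ⊗ e₀`:
`R̲(T₁) = 4(a+2)`, `R̲(T₂) = a`, and `R̲(T₁ ⊕ T₂) = 4(a+2) + 1`. -/
theorem construction2 (a : ℕ) (ha : 2 ≤ a) :
    borderRank (spider3 2 2 (a + 2)) = 4 * (a + 2) ∧
    borderRank (matTensor4 a) = a ∧
    borderRank (dsum (spider3 2 2 (a + 2)) (matTensor4 a)) = 4 * (a + 2) + 1 := by
  have : NeZero a := ⟨by omega⟩
  have hcard : Fintype.card (Fin 2 × Fin 2 × Fin (a + 2)) = 4 * (a + 2) := by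
    simp
    ring
  refine ⟨borderRank_eq ?_ fun s hs => ?_, borderRank_eq ?_ fun s hs => ?_,
    borderRank_eq (hasBorderRankLE_dsum a) fun s hs => ?_⟩
  · rw [spider3_eq, ← hcard]
    exact (hasRankLE_sum _).hasBorderRankLE
  · exact hcard ▸ hs.card_le 3 _ _ (flattening_spider3 2 2 (a + 2))
  · rw [matTensor4_eq]
    simpa using (hasRankLE_sum (matVec a)).hasBorderRankLE
  · simpa using hs.card_le 0 _ _ (flattening_matTensor4 a)
  · have := hs.card_le 3 _ _ (flattening_dsum 2 2 (a + 2) a)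
    rwa [Fintype.card_sum, hcard, Fintype.card_fin] at this

end
end Subadditivity
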